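/- Let A be a weighted adjacency matrix on n ≥ 1 vertices whose support graph is connected, and let Q = D + A be its signless Laplacian. Then the kernel of Q has dimension at most one; that is, any two vectors x, y ∈ ℝⁿ with Qx = 0 and Qy = 0 are linearly dependent. In particular, if the support graph is moreover bipartite, zero is a simple eigenvalue of Q. -/

import Mathlib

open Matrix

section SignlessLaplacian

variable {ι : Type*} [Fintype ι] [DecidableEq ι] {A : Matrix ι ι ℝ}

theorem signlessLaplacian_mulVec_apply (A : Matrix ι ι ℝ) (x : ι → ℝ) (i : ι) :
    ((diagonal fun i => ∑ j, A i j) + A).mulVec x i = ∑ j, A i j * (x i + x j) := by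
  rw [add_mulVec, Pi.add_apply, mulVec_diagonal, Finset.sum_mul]
  simp only [mulVec, dotProduct, mul_add, Finset.sum_add_distrib]

/-- The quadratic form of the signless Laplacian is a sum of squares over the edges. -/
theorem two_mul_dotProduct_signlessLaplacian_mulVec (hsymm : A.IsSymm) (x : ι → ℝ) :
    2 * (x ⬝ᵥ ((diagonal fun i => ∑ j, A i j) + A).mulVec x) =
      ∑ i, ∑ j, A i j * (x i + x j) ^ 2 := by
  have h : x ⬝ᵥ ((diagonal fun i => ∑ j, A i j) + A).mulVec x =
      ∑ i, ∑ j, A i j * (x i + x j) * x i := by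
    simp only [dotProduct, signlessLaplacian_mulVec_apply, Finset.mul_sum]
    exact Finset.sum_congr rfl fun i _ => Finset.sum_congr rfl fun j _ => by ring
  have h' : ∑ i, ∑ j, A i j * (x i + x j) * x i = ∑ i, ∑ j, A i j * (x i + x j) * x j := by
    rw [Finset.sum_comm]
    exact Finset.sum_congr rfl fun i _ => Finset.sum_congr rfl fun j _ => by
      rw [hsymm.apply i j, add_comm (x j)]
  rw [two_mul, h]
  nth_rewrite 2 [h']
  simp only [← Finset.sum_add_distrib]
  exact Finset.sum_congr rfl fun i _ => Finset.sum_congr rfl fun j _ => by ring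

theorem add_eq_zero_of_signlessLaplacian_mulVec_eq_zero (hsymm : A.IsSymm)
    (hnonneg : ∀ i j, 0 ≤ A i j) {x : ι → ℝ}
    (hx : ((diagonal fun i => ∑ j, A i j) + A).mulVec x = 0) {i j : ι} (hij : 0 < A i j) :
    x i + x j = 0 := by
  have h := two_mul_dotProduct_signlessLaplacian_mulVec hsymm x
  rw [hx, dotProduct_zero, mul_zero] at h
  have hterm : ∀ i j, 0 ≤ A i j * (x i + x j) ^ 2 := fun i j =>
    mul_nonneg (hnonneg i j) (sq_nonneg _)
  have hrow := (Finset.sum_eq_zero_iff_of_nonneg fun i _ =>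
    Finset.sum_nonneg fun j _ => hterm i j).1 h.symm i (Finset.mem_univ i)
  have hentry := (Finset.sum_eq_zero_iff_of_nonneg fun j _ => hterm i j).1 hrow j
    (Finset.mem_univ j)
  exact pow_eq_zero_iff two_ne_zero |>.1 ((mul_eq_zero.1 hentry).resolve_left hij.ne')

theorem eq_zero_of_signlessLaplacian_mulVec_eq_zero (hsymm : A.IsSymm)
    (hnonneg : ∀ i j, 0 ≤ A i j)
    (hconn : (SimpleGraph.fromRel fun i j => 0 < A i j).Connected) {x : ι → ℝ}
    (hx : ((diagonal fun i => ∑ j, A i j) + A).mulVec x = 0) {v : ι} (hv : x v = 0) :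
    x = 0 := by
  have hstep : ∀ i j, (SimpleGraph.fromRel fun i j => 0 < A i j).Adj i j →
      x i = 0 → x j = 0 := by
    intro i j hadj hi
    have hij : 0 < A i j := by
      rcases ((SimpleGraph.fromRel_adj _ i j).1 hadj).2 with h | h
      · exact h
      · rwa [hsymm.apply i j] at h
    simpa [hi] using add_eq_zero_of_signlessLaplacian_mulVec_eq_zero hsymm hnonneg hx hij
  have hwalk : ∀ i j, (SimpleGraph.fromRel fun i j => 0 < A i j).Walk i j →
      x i = 0 → x j = 0 := by
    intro i j p
    induction p with
    | nil => exact id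
    | cons hadj _ ih => exact fun hi => ih (hstep _ _ hadj hi)
  funext j
  obtain ⟨p⟩ := hconn.preconnected v j
  exact hwalk v j p hv

open Classical in
/-- The sign vector of a bipartition of the support graph lies in the kernel of the signless
Laplacian. -/
theorem signlessLaplacian_mulVec_sign_eq_zero (hnonneg : ∀ i j, 0 ≤ A i j)
    (hdiag : ∀ i, A i i = 0) {S : Set ι}
    (hS : ∀ i j, (SimpleGraph.fromRel fun i j => 0 < A i j).Adj i j → (i ∈ S ↔ j ∉ S)) :
    ((diagonal fun i => ∑ j, A i j) + A).mulVec (fun i => if i ∈ S then (1 : ℝ) else -1) = 0 := by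
  funext i
  rw [signlessLaplacian_mulVec_apply]
  refine Finset.sum_eq_zero fun j _ => ?_
  rcases (hnonneg i j).eq_or_lt with h | h
  · rw [← h, zero_mul]
  · have hne : i ≠ j := by
      rintro rfl
      exact h.ne' (hdiag i)
    have hij := hS i j ((SimpleGraph.fromRel_adj _ i j).2 ⟨hne, Or.inl h⟩)
    by_cases hj : j ∈ S <;> simp [hij, hj]

end SignlessLaplacian

/-- For a weighted adjacency matrix `A` on `n ≥ 1` vertices with connected
support graph and signless Laplacian `Q = D + A`, the kernel of `Q` has dimension at most
one: any two kernel vectors are linearly dependent. In particular, if the support graph is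
moreover bipartite, zero is a simple eigenvalue of `Q` (the kernel has dimension exactly one). -/
theorem signless_laplacian_kernel_dim_le_one
    (n : ℕ) (hn : 1 ≤ n) (A : Matrix (Fin n) (Fin n) ℝ)
    (hsymm : A.IsSymm) (hnonneg : ∀ i j, 0 ≤ A i j) (hdiag : ∀ i, A i i = 0)
    (hconn : (SimpleGraph.fromRel fun i j => 0 < A i j).Connected)
    (Q : Matrix (Fin n) (Fin n) ℝ)
    (hQ : Q = Matrix.diagonal (fun i => ∑ j, A i j) + A) :
    (∀ x y : Fin n → ℝ, Q.mulVec x = 0 → Q.mulVec y = 0 →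
      ∃ c d : ℝ, ¬(c = 0 ∧ d = 0) ∧ c • x + d • y = 0) ∧
    ((∃ S : Set (Fin n), ∀ i j,
        (SimpleGraph.fromRel fun i j => 0 < A i j).Adj i j → (i ∈ S ↔ j ∉ S)) →
      Module.finrank ℝ ↥(LinearMap.ker Q.mulVecLin) = 1) := by
  subst hQ
  have hzero : ∀ (c d : ℝ) (x y : Fin n → ℝ) (v : Fin n),
      ((diagonal fun i => ∑ j, A i j) + A).mulVec x = 0 →
      ((diagonal fun i => ∑ j, A i j) + A).mulVec y = 0 →
      c * x v + d * y v = 0 → c • x + d • y = 0 := fun c d x y v hx hy hv =>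
    eq_zero_of_signlessLaplacian_mulVec_eq_zero hsymm hnonneg hconn (v := v)
      (by rw [mulVec_add, mulVec_smul, mulVec_smul, hx, hy, smul_zero, smul_zero, add_zero])
      (by simpa using hv)
  let v : Fin n := ⟨0, hn⟩
  constructor
  · intro x y hx hy
    by_cases hxv : x v = 0
    · exact ⟨1, 0, by simp, hzero 1 0 x y v hx hy (by simp [hxv])⟩
    · exact ⟨y v, -x v, by simp [hxv], hzero _ _ x y v hx hy (by ring)⟩
  · rintro ⟨S, hS⟩
    classical
    have hs := signlessLaplacian_mulVec_sign_eq_zero hnonneg hdiag hS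
    set s : Fin n → ℝ := fun i => if i ∈ S then 1 else -1 with hs_def
    have hsv : s v ≠ 0 := by
      by_cases hv : v ∈ S <;> simp [hs_def, hv]
    refine finrank_eq_one (⟨s, hs⟩ :
      LinearMap.ker ((diagonal fun i => ∑ j, A i j) + A).mulVecLin) ?_ ?_
    · intro h
      exact hsv (congrFun (congrArg Subtype.val h) v)
    · rintro ⟨w, hw⟩
      refine ⟨w v / s v, Subtype.ext ?_⟩
      have h := hzero (w v / s v) (-1) s w v hs hw
        (by rw [div_mul_cancel₀ _ hsv]; ring)
      rw [neg_one_smul, ← sub_eq_add_neg] at h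
      exact sub_eq_zero.1 h
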